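/- Let (G, H) be a mixed graph on n vertices with at least one edge, and let Q = D + H be its γ-signless Laplacian adjacency matrix with largest eigenvalue λ₁ and smallest eigenvalue λₙ. Then λ₁ − λₙ ≥ 2. -/

import Mathlib

open Matrix Complex BigOperators

noncomputable def gamma : ℂ := Complex.exp (2 * Real.pi * Complex.I / 3)

open scoped ComplexOrder MatrixOrder in
lemma Matrix.IsHermitian.posSemidef_iSup_eigenvalues_sub {V : Type*} [Fintype V] [DecidableEq V]
    {A : Matrix V V ℂ} (hA : A.IsHermitian) :
    (algebraMap ℝ (Matrix V V ℂ) (⨆ i, hA.eigenvalues i) - A).PosSemidef := by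
  rw [← Matrix.le_iff, le_algebraMap_iff_spectrum_le (ha := hA.isSelfAdjoint),
    hA.spectrum_real_eq_range_eigenvalues]
  rintro _ ⟨i, rfl⟩
  exact le_ciSup (Set.finite_range _).bddAbove i

open scoped ComplexOrder MatrixOrder in
lemma Matrix.IsHermitian.posSemidef_sub_iInf_eigenvalues {V : Type*} [Fintype V] [DecidableEq V]
    {A : Matrix V V ℂ} (hA : A.IsHermitian) :
    (A - algebraMap ℝ (Matrix V V ℂ) (⨅ i, hA.eigenvalues i)).PosSemidef := by
  rw [← Matrix.le_iff, algebraMap_le_iff_le_spectrum (ha := hA.isSelfAdjoint),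
    hA.spectrum_real_eq_range_eigenvalues]
  rintro _ ⟨i, rfl⟩
  exact ciInf_le (Set.finite_range _).bddBelow i

open scoped ComplexOrder in
lemma Matrix.PosSemidef.re_two_by_two_nonneg {V : Type*} [Fintype V] [DecidableEq V]
    {M : Matrix V V ℂ} (hM : M.PosSemidef) (u v : V) (z : ℂ) :
    0 ≤ (M u u + z * M u v + star z * M v u + star z * z * M v v).re := by
  have h := (Complex.le_def.1
    (hM.dotProduct_mulVec_nonneg (Pi.single u 1 + Pi.single v z))).1
  have e : star (Pi.single u 1 + Pi.single v z : V → ℂ) ⬝ᵥ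
      (M *ᵥ (Pi.single u 1 + Pi.single v z)) =
      M u u + z * M u v + star z * M v u + star z * z * M v v := by
    simp only [star_add, Pi.star_single, star_one, Matrix.mulVec_add, add_dotProduct,
      dotProduct_add, single_dotProduct, Matrix.mulVec_single, Pi.smul_apply, Matrix.col_apply,
      MulOpposite.smul_eq_mul_unop, MulOpposite.unop_op]
    ring
  rwa [e] at h

/-- An off-diagonal entry of modulus one forces a gap of two between the extreme eigenvalues. -/
lemma Matrix.IsHermitian.two_le_spread_of_norm_eq_one {V : Type*} [Fintype V] [DecidableEq V]
    {A : Matrix V V ℂ} (hA : A.IsHermitian) {u v : V} (huv : u ≠ v) (h : ‖A u v‖ = 1) :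
    2 ≤ (⨆ i, hA.eigenvalues i) - (⨅ i, hA.eigenvalues i) := by
  have hs : A v u = star (A u v) := (hA.apply v u).symm
  have hn : (A u v).re * (A u v).re + (A u v).im * (A u v).im = 1 := by
    rw [← Complex.normSq_apply, Complex.normSq_eq_norm_sq, h, one_pow]
  have hmax := hA.posSemidef_iSup_eigenvalues_sub.re_two_by_two_nonneg u v (star (A u v))
  have hmin := hA.posSemidef_sub_iInf_eigenvalues.re_two_by_two_nonneg u v (-star (A u v))
  have hv : (A v v).im = 0 := Complex.conj_eq_iff_im.1 (hA.apply v v)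
  simp [Matrix.algebraMap_matrix_apply, huv, huv.symm, hs] at hmax hmin
  have hn' : (A u v).im * (A u v).im = 1 - (A u v).re * (A u v).re := by linarith
  nlinarith

lemma norm_gamma : ‖gamma‖ = 1 := by
  rw [gamma, show 2 * (Real.pi : ℂ) * Complex.I / 3 = ((2 * Real.pi / 3 : ℝ) : ℂ) * Complex.I by
    push_cast; ring]
  exact Complex.norm_exp_ofReal_mul_I _

/-- For a mixed graph with at least one edge, the spread of the γ-signless Laplacian
satisfies `λ₁ − λₙ ≥ 2`. -/
theorem signless_laplacian_spread_ge_two {V : Type*} [Fintype V] [DecidableEq V] [Nonempty V]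
    (G : SimpleGraph V) [DecidableRel G.Adj] (hE : G.edgeFinset.Nonempty)
    (H : Matrix V V ℂ) (hH : H.IsHermitian)
    (hadj : ∀ u v, G.Adj u v → H u v ∈ ({1, gamma, gamma ^ 2} : Set ℂ))
    (hnadj : ∀ u v, ¬ G.Adj u v → H u v = 0)
    (hQ : (Matrix.diagonal (fun u => (G.degree u : ℂ)) + H).IsHermitian) :
    (⨆ i, hQ.eigenvalues i) - (⨅ i, hQ.eigenvalues i) ≥ 2 := by
  obtain ⟨e, he⟩ := hE
  induction e using Sym2.ind with
  | h u v =>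
    have huv : G.Adj u v := by simpa using he
    refine hQ.two_le_spread_of_norm_eq_one huv.ne ?_
    rw [Matrix.add_apply, Matrix.diagonal_apply_ne _ huv.ne, zero_add]
    obtain h | h | h : H u v = 1 ∨ H u v = gamma ∨ H u v = gamma ^ 2 := by
      simpa using hadj u v huv
    all_goals simp [h, norm_gamma]
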